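/- arXiv:1810.07072 — 2 statements merged into one kernel-verified Lean document; each statement's English description precedes it below -/
import Mathlib

section
/- Let n ≥ 1 be a natural number. Let ℓ, b, r, t and L, B, R, T be natural numbers, all at most 2n−1, with ℓ < r, b < t, L < R, B < T, such that ℓ, r, L, R are pairwise distinct and b, t, B, T are pairwise distinct, and let σ, τ ∈ Bool. Write S₁ := Dₙ(ℓ,b,r,t) and K₁ := C(ℓ,b,r,t) if σ = false, and S₁ := Uₙ(ℓ,b,r,t) and K₁ := C'(ℓ,b,r,t) if σ = true; similarly write S₂ := Dₙ(L,B,R,T) and K₂ := C(L,B,R,T) if τ = false, and S₂ := Uₙ(L,B,R,T) and K₂ := C'(L,B,R,T) if τ = true. If S₁ ∩ S₂ ≠ ∅, then K₁ ∩ K₂ ≠ ∅. -/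
/-- The rotated-L curve: top and right sides of the rectangle `[l,r] × [b,t]`. -/
def rotL (l b r t : ℝ) : Set (ℝ × ℝ) :=
  segment ℝ (l, t) (r, t) ∪ segment ℝ (r, b) (r, t)

/-- The rotated-⅃ curve: top and left sides of the rectangle `[l,r] × [b,t]`. -/
def rotL' (l b r t : ℝ) : Set (ℝ × ℝ) :=
  segment ℝ (l, t) (r, t) ∪ segment ℝ (l, b) (l, t)

/-- The downward diagonal of the rectangle `[l,r] × [(2n)^b,(2n)^t]`. -/
def Dn (n l b r t : ℕ) : Set (ℝ × ℝ) :=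
  segment ℝ ((l:ℝ), (2 * (n:ℝ))^t) ((r:ℝ), (2 * (n:ℝ))^b)

/-- The upward diagonal of the rectangle `[l,r] × [(2n)^b,(2n)^t]`. -/
def Un (n l b r t : ℕ) : Set (ℝ × ℝ) :=
  segment ℝ ((l:ℝ), (2 * (n:ℝ))^b) ((r:ℝ), (2 * (n:ℝ))^t)

theorem mem_segment_horizontal {a b x y : ℝ} (h₁ : a ≤ x) (h₂ : x ≤ b) :
    (x, y) ∈ segment ℝ (a, y) (b, y) := by
  rw [← Prod.image_mk_segment_left, segment_eq_Icc (h₁.trans h₂)]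
  exact ⟨x, ⟨h₁, h₂⟩, rfl⟩

theorem mem_segment_vertical {a b x y : ℝ} (h₁ : a ≤ y) (h₂ : y ≤ b) :
    (x, y) ∈ segment ℝ (x, a) (x, b) := by
  rw [← Prod.image_mk_segment_right, segment_eq_Icc (h₁.trans h₂)]
  exact ⟨y, ⟨h₁, h₂⟩, rfl⟩

theorem fst_mem_Icc_of_mem_segment {p u v : ℝ × ℝ} (h : p ∈ segment ℝ u v) (huv : u.1 ≤ v.1) :
    p.1 ∈ Set.Icc u.1 v.1 := by
  obtain ⟨a, c, ha, hc, hac, rfl⟩ := h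
  have : a • u.1 + c • v.1 ∈ segment ℝ u.1 v.1 := ⟨a, c, ha, hc, hac, rfl⟩
  rwa [segment_eq_Icc huv] at this

theorem snd_mem_Icc_of_mem_segment {p u v : ℝ × ℝ} (h : p ∈ segment ℝ u v) (huv : u.2 ≤ v.2) :
    p.2 ∈ Set.Icc u.2 v.2 := by
  obtain ⟨a, c, ha, hc, hac, rfl⟩ := h
  have : a • u.2 + c • v.2 ∈ segment ℝ u.2 v.2 := ⟨a, c, ha, hc, hac, rfl⟩
  rwa [segment_eq_Icc huv] at this

/-- A point of height at most `N ^ t` on a segment descending from height `N ^ T`, `t < T`, is at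
horizontal distance less than one from the lower endpoint, if the segment has horizontal extent at
most `N - 1`. -/
theorem abs_fst_sub_lt_one_of_mem_segment {N v w : ℝ} {t B T : ℕ} {p : ℝ × ℝ} (hN : 1 < N)
    (htT : t < T) (hvw : |w - v| ≤ N - 1) (hp : p ∈ segment ℝ (v, N ^ B) (w, N ^ T))
    (hpt : p.2 ≤ N ^ t) : |p.1 - v| < 1 := by
  obtain ⟨c, a, hc, ha, hac, rfl⟩ := hp
  simp only [Prod.smul_mk, Prod.mk_add_mk, smul_eq_mul] at hpt ⊢
  have hN0 : 0 < N := by linarith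
  have hpow : N * N ^ t ≤ N ^ T := by
    rw [← pow_succ']
    exact pow_le_pow_right₀ hN.le htT
  have haN : a * N ≤ 1 := by
    refine le_of_mul_le_mul_right ?_ (pow_pos hN0 t)
    have := mul_le_mul_of_nonneg_left hpow ha
    have := mul_nonneg hc (pow_pos hN0 B).le
    linarith
  have heq : c * v + a * w - v = a * (w - v) := by
    obtain rfl : c = 1 - a := by linarith
    ring
  rw [heq, abs_mul, abs_of_nonneg ha]
  have := mul_le_mul_of_nonneg_left hvw ha
  rcases ha.eq_or_lt with rfl | ha'
  · simp
  · linarith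

/-- If two diagonals meet, the vertical side of the curve with the higher top crosses the top side
of the other curve. -/
theorem edge_inter_nonempty_of_top_lt {n l b r t L B R T : ℕ} (hn : 1 ≤ n)
    (hL : L ≤ 2 * n - 1) (hR : R ≤ 2 * n - 1)
    (hlr : l < r) (hbt : b < t) (hLR : L < R) (htT : t < T) (hBT : B < T) (σ τ : Bool)
    (h : ((if σ then Un n l b r t else Dn n l b r t) ∩
          (if τ then Un n L B R T else Dn n L B R T)).Nonempty) :
    ((if σ then rotL' (l:ℝ) (b:ℝ) (r:ℝ) (t:ℝ) else rotL (l:ℝ) (b:ℝ) (r:ℝ) (t:ℝ)) ∩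
     (if τ then rotL' (L:ℝ) (B:ℝ) (R:ℝ) (T:ℝ) else rotL (L:ℝ) (B:ℝ) (R:ℝ) (T:ℝ))).Nonempty := by
  obtain ⟨p, hp₁, hp₂⟩ := h
  have hN : (1 : ℝ) < 2 * n := by
    have : (1 : ℝ) ≤ n := by exact_mod_cast hn
    linarith
  have hlr' : (l : ℝ) ≤ r := by exact_mod_cast hlr.le
  have hbt' : (2 * (n : ℝ)) ^ b ≤ (2 * (n : ℝ)) ^ t := pow_le_pow_right₀ hN.le hbt.le
  have hBT' : (2 * (n : ℝ)) ^ B ≤ (2 * (n : ℝ)) ^ T := pow_le_pow_right₀ hN.le hBT.le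
  have hwidth : (R : ℝ) - L ≤ 2 * n - 1 := by
    have : (R : ℝ) + 1 ≤ 2 * n := by exact_mod_cast (by omega : R + 1 ≤ 2 * n)
    have : (0 : ℝ) ≤ L := L.cast_nonneg
    linarith
  have hLR' : (0 : ℝ) ≤ R - L := sub_nonneg.2 (by exact_mod_cast hLR.le)
  have hbox : p.1 ∈ Set.Icc (l : ℝ) r ∧ p.2 ≤ (2 * (n : ℝ)) ^ t := by
    cases σ
    · have hp : p ∈ segment ℝ ((r : ℝ), (2 * (n : ℝ)) ^ b) ((l : ℝ), (2 * (n : ℝ)) ^ t) := by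
        rw [segment_symm]
        exact hp₁
      exact ⟨fst_mem_Icc_of_mem_segment hp₁ hlr', (snd_mem_Icc_of_mem_segment hp hbt').2⟩
    · exact ⟨fst_mem_Icc_of_mem_segment hp₁ hlr', (snd_mem_Icc_of_mem_segment hp₁ hbt').2⟩
  obtain ⟨⟨hlp, hpr⟩, hpt⟩ := hbox
  have key (v w : ℕ) (hvw : |(w : ℝ) - v| ≤ 2 * n - 1)
      (hp : p ∈ segment ℝ ((v : ℝ), (2 * (n : ℝ)) ^ B) ((w : ℝ), (2 * (n : ℝ)) ^ T)) :
      ((v : ℝ), (t : ℝ)) ∈ segment ℝ ((l : ℝ), (t : ℝ)) ((r : ℝ), (t : ℝ)) ∧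
        ((v : ℝ), (t : ℝ)) ∈ segment ℝ ((v : ℝ), (B : ℝ)) ((v : ℝ), (T : ℝ)) := by
    have hBt : B ≤ t :=
      (pow_le_pow_iff_right₀ hN).1 ((snd_mem_Icc_of_mem_segment hp hBT').1.trans hpt)
    obtain ⟨h₁, h₂⟩ := abs_lt.1 (abs_fst_sub_lt_one_of_mem_segment hN htT hvw hp hpt)
    have hlv : l < v + 1 := by
      have : (l : ℝ) < v + 1 := by linarith
      exact_mod_cast this
    have hvr : v < r + 1 := by
      have : (v : ℝ) < r + 1 := by linarith
      exact_mod_cast this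
    exact ⟨mem_segment_horizontal (by exact_mod_cast Nat.lt_succ_iff.1 hlv)
        (by exact_mod_cast Nat.lt_succ_iff.1 hvr),
      mem_segment_vertical (by exact_mod_cast hBt) (by exact_mod_cast htT.le)⟩
  have htop (v : ℕ) (hv : ((v : ℝ), (t : ℝ)) ∈ segment ℝ ((l : ℝ), (t : ℝ)) ((r : ℝ), (t : ℝ))) :
      ((v : ℝ), (t : ℝ)) ∈ (if σ then rotL' (l:ℝ) (b:ℝ) (r:ℝ) (t:ℝ)
        else rotL (l:ℝ) (b:ℝ) (r:ℝ) (t:ℝ)) := by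
    cases σ
    · exact Or.inl hv
    · exact Or.inl hv
  cases τ
  · obtain ⟨h₁, h₂⟩ := key R L (by rwa [abs_sub_comm, abs_of_nonneg hLR'])
      (by rw [segment_symm]; exact hp₂)
    exact ⟨_, htop R h₁, Or.inr h₂⟩
  · obtain ⟨h₁, h₂⟩ := key L R (by rwa [abs_of_nonneg hLR']) hp₂
    exact ⟨_, htop L h₁, Or.inr h₂⟩

theorem edge_of_diagonals_intersect
    (n : ℕ) (hn : 1 ≤ n) (l b r t L B R T : ℕ)
    (hl : l ≤ 2*n - 1) (hb : b ≤ 2*n - 1) (hr : r ≤ 2*n - 1) (ht : t ≤ 2*n - 1)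
    (hL : L ≤ 2*n - 1) (hB : B ≤ 2*n - 1) (hR : R ≤ 2*n - 1) (hT : T ≤ 2*n - 1)
    (hlr : l < r) (hbt : b < t) (hLR : L < R) (hBT : B < T)
    (hx : ([l, r, L, R] : List ℕ).Pairwise (· ≠ ·))
    (hy : ([b, t, B, T] : List ℕ).Pairwise (· ≠ ·))
    (σ τ : Bool)
    (h : ((if σ then Un n l b r t else Dn n l b r t) ∩
          (if τ then Un n L B R T else Dn n L B R T)).Nonempty) :
    ((if σ then rotL' (l:ℝ) (b:ℝ) (r:ℝ) (t:ℝ) else rotL (l:ℝ) (b:ℝ) (r:ℝ) (t:ℝ)) ∩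
     (if τ then rotL' (L:ℝ) (B:ℝ) (R:ℝ) (T:ℝ) else rotL (L:ℝ) (B:ℝ) (R:ℝ) (T:ℝ))).Nonempty := by
  have htT : t ≠ T := by
    simp only [List.pairwise_cons, List.mem_cons] at hy
    exact hy.2.1 T (by simp)
  rcases htT.lt_or_gt with htT | hTt
  · exact edge_inter_nonempty_of_top_lt hn hL hR hlr hbt hLR htT hBT σ τ h
  · rw [Set.inter_comm] at h ⊢
    exact edge_inter_nonempty_of_top_lt hn hl hr hLR hBT hlr hTt hbt τ σ h
end

section
/- Let ℓ, b, r, t, L, B, R, T be real numbers with ℓ < r, b < t, L < R, B < T, such that ℓ, r, L, R are pairwise distinct and b, t, B, T are pairwise distinct. Then C(ℓ,b,r,t) ∩ C(L,B,R,T) ≠ ∅ if and only if (L < r and r < R and b < T and T < t) or (ℓ < R and R < r and B < t and t < T). -/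
theorem mem_rotL_iff {l b r t : ℝ} (hlr : l ≤ r) (hbt : b ≤ t) (x y : ℝ) :
    (x, y) ∈ rotL l b r t ↔ (y = t ∧ l ≤ x ∧ x ≤ r) ∨ (x = r ∧ b ≤ y ∧ y ≤ t) := by
  rw [rotL, ← Prod.image_mk_segment_left, ← Prod.image_mk_segment_right,
    segment_eq_Icc hlr, segment_eq_Icc hbt]
  simp only [Set.mem_union, Set.mem_image, Set.mem_Icc, Prod.mk.injEq]
  grind

theorem rotL_intersect_iff
    (l b r t L B R T : ℝ)
    (hlr : l < r) (hbt : b < t) (hLR : L < R) (hBT : B < T)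
    (hx : ([l, r, L, R] : List ℝ).Pairwise (· ≠ ·))
    (hy : ([b, t, B, T] : List ℝ).Pairwise (· ≠ ·)) :
    (rotL l b r t ∩ rotL L B R T).Nonempty ↔
      ((L < r ∧ r < R ∧ b < T ∧ T < t) ∨ (l < R ∧ R < r ∧ B < t ∧ t < T)) := by
  simp only [Set.Nonempty, Set.mem_inter_iff, Prod.exists, mem_rotL_iff hlr.le hbt.le,
    mem_rotL_iff hLR.le hBT.le]
  simp only [List.pairwise_cons, List.mem_cons, List.not_mem_nil, or_false, forall_eq_or_imp,
    forall_eq] at hx hy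
  constructor
  · obtain ⟨⟨-, -, hlR⟩, ⟨hrL, hrR⟩, -⟩ := hx
    obtain ⟨⟨-, -, hbT⟩, ⟨htB, htT⟩, -⟩ := hy
    rintro ⟨x, y, ⟨rfl, h₁, h₂⟩ | ⟨rfl, h₁, h₂⟩, ⟨h, h₃, h₄⟩ | ⟨h, h₃, h₄⟩⟩
    · exact absurd h htT
    · subst h
      exact .inr ⟨lt_of_le_of_ne h₁ hlR, lt_of_le_of_ne h₂ hrR.symm,
        lt_of_le_of_ne h₃ htB.symm, lt_of_le_of_ne h₄ htT⟩
    · subst h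
      exact .inl ⟨lt_of_le_of_ne h₃ hrL.symm, lt_of_le_of_ne h₄ hrR,
        lt_of_le_of_ne h₁ hbT, lt_of_le_of_ne h₂ htT.symm⟩
    · exact absurd h hrR
  · rintro (⟨h₁, h₂, h₃, h₄⟩ | ⟨h₁, h₂, h₃, h₄⟩)
    · exact ⟨r, T, .inr ⟨rfl, h₃.le, h₄.le⟩, .inl ⟨rfl, h₁.le, h₂.le⟩⟩
    · exact ⟨R, t, .inl ⟨rfl, h₁.le, h₂.le⟩, .inr ⟨rfl, h₃.le, h₄.le⟩⟩
end
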